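/- arXiv:1809.09698 — 5 statements merged into one kernel-verified Lean document; each statement's English description precedes it below -/
import Mathlib

section
/- Let n ≥ 1 be a natural number, let ε ∈ (0,1] be a real number, and let F be an n×n real symmetric positive definite matrix. Then there exists a unique θ* ∈ (0, λ_min(F)) satisfying (ε·θ*/n)·Tr((F − θ*·I)^{-1}) = 1, and this θ* is the unique maximizer of the function Φ(x) := ln x + (ε/n)·ln det(F − x·I) over the interval (0, λ_min(F)). -/
/-- Diagonalization of a real symmetric matrix with explicit inverse pair. -/
lemma aux_diag {n : ℕ} (F : Matrix (Fin n) (Fin n) ℝ) (hF : F.IsHermitian) :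
    ∃ U V : Matrix (Fin n) (Fin n) ℝ, U * V = 1 ∧ V * U = 1 ∧
      ∀ x : ℝ, F - x • (1 : Matrix (Fin n) (Fin n) ℝ) =
        U * Matrix.diagonal (fun i => hF.eigenvalues i - x) * V := by
  have h1 : (hF.eigenvectorUnitary : Matrix (Fin n) (Fin n) ℝ) *
      star (hF.eigenvectorUnitary : Matrix (Fin n) (Fin n) ℝ) = 1 := by simp
  have h2 : star (hF.eigenvectorUnitary : Matrix (Fin n) (Fin n) ℝ) *
      (hF.eigenvectorUnitary : Matrix (Fin n) (Fin n) ℝ) = 1 := by simp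
  have h3 := hF.spectral_theorem
  rw [Unitary.conjStarAlgAut_apply] at h3
  refine ⟨_, _, h1, h2, fun x => ?_⟩
  have h4 : Matrix.diagonal (fun i => hF.eigenvalues i - x) =
      Matrix.diagonal (RCLike.ofReal ∘ hF.eigenvalues) -
        x • (1 : Matrix (Fin n) (Fin n) ℝ) := by
    ext i j
    by_cases h : i = j
    · subst h; simp
    · simp [h]
  rw [h4, mul_sub, sub_mul, ← h3, mul_smul_comm, mul_one, smul_mul_assoc, h1]

lemma aux_det {n : ℕ} (F : Matrix (Fin n) (Fin n) ℝ) (hF : F.IsHermitian) (x : ℝ) :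
    (F - x • (1 : Matrix (Fin n) (Fin n) ℝ)).det = ∏ i, (hF.eigenvalues i - x) := by
  obtain ⟨U, V, h1, h2, h⟩ := aux_diag F hF
  rw [h x, Matrix.det_mul_comm, ← mul_assoc, h2, one_mul, Matrix.det_diagonal]

lemma aux_trace {n : ℕ} (F : Matrix (Fin n) (Fin n) ℝ) (hF : F.IsHermitian) (x : ℝ)
    (hx : ∀ i, hF.eigenvalues i - x ≠ 0) :
    ((F - x • (1 : Matrix (Fin n) (Fin n) ℝ))⁻¹).trace = ∑ i, (hF.eigenvalues i - x)⁻¹ := by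
  obtain ⟨U, V, h1, h2, h⟩ := aux_diag F hF
  have hd : Matrix.diagonal (fun i => hF.eigenvalues i - x) *
      Matrix.diagonal (fun i => (hF.eigenvalues i - x)⁻¹) = 1 := by
    rw [Matrix.diagonal_mul_diagonal, ← Matrix.diagonal_one]
    congr 1
    funext i
    exact mul_inv_cancel₀ (hx i)
  have hinv : (F - x • (1 : Matrix (Fin n) (Fin n) ℝ))⁻¹ =
      U * Matrix.diagonal (fun i => (hF.eigenvalues i - x)⁻¹) * V := by
    apply Matrix.inv_eq_right_inv
    rw [h x]
    calc _ = U * (Matrix.diagonal (fun i => hF.eigenvalues i - x) * (V * U) *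
          Matrix.diagonal (fun i => (hF.eigenvalues i - x)⁻¹)) * V := by
            simp only [mul_assoc]
      _ = 1 := by rw [h2, mul_one, hd, mul_one, h1]
  rw [hinv, Matrix.trace_mul_comm, ← mul_assoc, h2, one_mul, Matrix.trace_diagonal]

/-- A critical point is a strict maximizer, by concavity of the logarithm. -/
lemma aux_max {n : ℕ} (μ : Fin n → ℝ) (c θ x : ℝ) (hc : 0 < c) (hθ : 0 < θ) (hx : 0 < x)
    (hμθ : ∀ i, 0 < μ i - θ) (hμx : ∀ i, 0 < μ i - x) (hne : x ≠ θ)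
    (hcrit : c * θ * ∑ i, (μ i - θ)⁻¹ = 1) :
    Real.log x + c * Real.log (∏ i, (μ i - x)) <
      Real.log θ + c * Real.log (∏ i, (μ i - θ)) := by
  rw [Real.log_prod (fun i _ => (hμx i).ne'), Real.log_prod (fun i _ => (hμθ i).ne')]
  have h1 : Real.log x - Real.log θ < x / θ - 1 := by
    rw [← Real.log_div hx.ne' hθ.ne']
    refine Real.log_lt_sub_one_of_pos (div_pos hx hθ) ?_
    rw [Ne, div_eq_one_iff_eq hθ.ne']
    exact hne
  have h2 : ∑ i, Real.log (μ i - x) ≤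
      ∑ i, (Real.log (μ i - θ) + (θ - x) * (μ i - θ)⁻¹) := by
    refine Finset.sum_le_sum fun i _ => ?_
    have := Real.log_le_sub_one_of_pos (div_pos (hμx i) (hμθ i))
    rw [Real.log_div (hμx i).ne' (hμθ i).ne'] at this
    have e : (μ i - x) / (μ i - θ) - 1 = (θ - x) * (μ i - θ)⁻¹ := by
      have := (hμθ i).ne'
      field_simp
      ring
    linarith
  rw [Finset.sum_add_distrib, ← Finset.mul_sum] at h2
  have h3 := mul_le_mul_of_nonneg_left h2 hc.le
  have h4 : c * ∑ i, (μ i - θ)⁻¹ = 1 / θ := by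
    rw [eq_div_iff hθ.ne']; linarith
  have h5 : c * ((θ - x) * ∑ i, (μ i - θ)⁻¹) = 1 - x / θ := by
    rw [mul_left_comm, h4]; field_simp
  rw [mul_add, h5] at h3
  linarith

lemma aux_exists {n : ℕ} (hn : 1 ≤ n) (ε : ℝ) (hε : ε ∈ Set.Ioc (0 : ℝ) 1)
    (μ : Fin n → ℝ) (lam : ℝ) (hl : 0 < lam) (hμ : ∀ i, lam ≤ μ i) (i₀ : Fin n)
    (hi₀ : μ i₀ = lam) :
    ∃ θ ∈ Set.Ioo (0 : ℝ) lam, (ε * θ / (n : ℝ)) * ∑ i, (μ i - θ)⁻¹ = 1 := by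
  obtain ⟨h0, h1⟩ := hε
  have hn' : (1 : ℝ) ≤ n := by exact_mod_cast hn
  have hn0 : (0 : ℝ) < n := by linarith
  set b : ℝ := n * lam / (ε + n) with hb
  have hs : 0 < ε + n := by linarith
  have hbl : b < lam := by
    rw [hb, div_lt_iff₀ hs]; nlinarith
  have hab : lam / 2 ≤ b := by
    rw [hb, le_div_iff₀ hs]; nlinarith
  have hb0 : 0 < b := by linarith
  have hcont : ContinuousOn (fun θ : ℝ => (ε * θ / (n : ℝ)) * ∑ i, (μ i - θ)⁻¹)
      (Set.Icc (lam / 2) b) := by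
    refine ContinuousOn.mul (by fun_prop) (continuousOn_finsetSum _ fun i _ => ?_)
    refine ContinuousOn.inv₀ (by fun_prop) fun y hy => ?_
    have := hμ i
    have := hy.2
    intro h
    linarith
  have hA : (ε * (lam / 2) / (n : ℝ)) * ∑ i, (μ i - lam / 2)⁻¹ ≤ 1 := by
    have hsum : ∑ i, (μ i - lam / 2)⁻¹ ≤ ∑ _i : Fin n, (lam / 2)⁻¹ := by
      refine Finset.sum_le_sum fun i _ => ?_
      have := hμ i
      exact inv_anti₀ (by linarith) (by linarith)
    rw [Finset.sum_const, Finset.card_univ, Fintype.card_fin, nsmul_eq_mul] at hsum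
    calc _ ≤ (ε * (lam / 2) / (n : ℝ)) * (n * (lam / 2)⁻¹) :=
          mul_le_mul_of_nonneg_left hsum (by positivity)
      _ = ε := by field_simp
      _ ≤ 1 := h1
  have hB : 1 ≤ (ε * b / (n : ℝ)) * ∑ i, (μ i - b)⁻¹ := by
    have hsum : (lam - b)⁻¹ ≤ ∑ i, (μ i - b)⁻¹ := by
      rw [← hi₀]
      refine Finset.single_le_sum (f := fun i => (μ i - b)⁻¹) (fun i _ => ?_)
        (Finset.mem_univ i₀)
      have := hμ i
      exact inv_nonneg.2 (by linarith)
    have e : ε * b = n * (lam - b) := by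
      have : b * (ε + n) = n * lam := by rw [hb]; field_simp
      linarith
    have hpos : 0 < lam - b := by linarith
    calc (1 : ℝ) = (ε * b / (n : ℝ)) * (lam - b)⁻¹ := by rw [e]; field_simp
      _ ≤ _ := mul_le_mul_of_nonneg_left hsum (by positivity)
  obtain ⟨θ, hθ, he⟩ := intermediate_value_Icc hab hcont ⟨hA, hB⟩
  exact ⟨θ, ⟨by linarith [hθ.1], by linarith [hθ.2]⟩, he⟩

/-- For `n ≥ 1`, `ε ∈ (0,1]` and `F ≻ 0` symmetric, there is a unique
`θ* ∈ (0, λ_min(F))` with `(ε·θ*/n)·Tr((F - θ*·I)⁻¹) = 1`, and this `θ*` is the unique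
maximizer of `Φ(x) = ln x + (ε/n)·ln det (F - x·I)` on `(0, λ_min(F))`. -/
theorem log_potential_unique_maximizer
    {n : ℕ} (hn : 1 ≤ n) (ε : ℝ) (hε : ε ∈ Set.Ioc (0 : ℝ) 1)
    (F : Matrix (Fin n) (Fin n) ℝ) (hF : F.PosDef)
    (lam : ℝ) (hlam : lam = ⨅ i, hF.1.eigenvalues i) :
    ∃ θ ∈ Set.Ioo (0 : ℝ) lam,
      (ε * θ / (n : ℝ)) * ((F - θ • (1 : Matrix (Fin n) (Fin n) ℝ))⁻¹).trace = 1 ∧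
      (∀ θ' ∈ Set.Ioo (0 : ℝ) lam,
        (ε * θ' / (n : ℝ)) * ((F - θ' • (1 : Matrix (Fin n) (Fin n) ℝ))⁻¹).trace = 1 →
        θ' = θ) ∧
      (∀ x ∈ Set.Ioo (0 : ℝ) lam, x ≠ θ →
        Real.log x + (ε / (n : ℝ)) *
            Real.log (F - x • (1 : Matrix (Fin n) (Fin n) ℝ)).det <
          Real.log θ + (ε / (n : ℝ)) *
            Real.log (F - θ • (1 : Matrix (Fin n) (Fin n) ℝ)).det) := by
  have hne : Nonempty (Fin n) := ⟨⟨0, hn⟩⟩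
  obtain ⟨i₀, hi₀⟩ := exists_eq_ciInf_of_finite (f := hF.1.eigenvalues)
  rw [← hlam] at hi₀
  have hl : 0 < lam := hi₀ ▸ hF.eigenvalues_pos i₀
  have hμ : ∀ i, lam ≤ hF.1.eigenvalues i := fun i => by
    rw [hlam]; exact ciInf_le (Set.finite_range _).bddBelow i
  have hpos : ∀ x ∈ Set.Ioo (0 : ℝ) lam, ∀ i, 0 < hF.1.eigenvalues i - x := fun x hx i => by
    have := hμ i
    have := hx.2
    linarith
  have hn0 : (0 : ℝ) < n := by exact_mod_cast hn
  have hc : 0 < ε / (n : ℝ) := div_pos hε.1 hn0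
  have hmax : ∀ θ ∈ Set.Ioo (0 : ℝ) lam,
      (ε * θ / (n : ℝ)) * ∑ i, (hF.1.eigenvalues i - θ)⁻¹ = 1 →
      ∀ x ∈ Set.Ioo (0 : ℝ) lam, x ≠ θ →
        Real.log x + (ε / (n : ℝ)) * Real.log (∏ i, (hF.1.eigenvalues i - x)) <
          Real.log θ + (ε / (n : ℝ)) * Real.log (∏ i, (hF.1.eigenvalues i - θ)) := by
    intro θ hθ he x hx hxe
    refine aux_max _ _ θ x hc hθ.1 hx.1 (hpos θ hθ) (hpos x hx) hxe ?_
    rw [← he]; ring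
  obtain ⟨θ, hθ, he⟩ := aux_exists hn ε hε hF.1.eigenvalues lam hl hμ i₀ hi₀
  refine ⟨θ, hθ, ?_, ?_, ?_⟩
  · rw [aux_trace F hF.1 θ fun i => (hpos θ hθ i).ne']
    exact he
  · intro θ' hθ' he'
    rw [aux_trace F hF.1 θ' fun i => (hpos θ' hθ' i).ne'] at he'
    by_contra hcon
    exact lt_asymm (hmax θ hθ he θ' hθ' hcon) (hmax θ' hθ' he' θ hθ (Ne.symm hcon))
  · intro x hx hxe
    rw [aux_det F hF.1, aux_det F hF.1]
    exact hmax θ hθ he x hx hxe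
end

section
/- Let n ≥ 1 be a natural number, let ε ∈ (0,1] be a real number, let F be an n×n real symmetric positive definite matrix, and define g(x) := (ε·x/n)·Tr((F − x·I)^{-1}) for x ∈ (0, λ_min(F)). Set δ := ε³/(32n). If θ* ∈ (0, λ_min(F)) satisfies g(θ*) = 1 and θ ∈ (0, λ_min(F)) satisfies (1 − δ)·θ* ≤ θ < θ*, then 1 − ε < g(θ) < 1. -/
theorem trace_resolvent_aux {n : ℕ} (F : Matrix (Fin n) (Fin n) ℝ) (hF : F.IsHermitian)
    (x : ℝ) (hx : ∀ i, x < hF.eigenvalues i) :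
    ((F - x • (1 : Matrix (Fin n) (Fin n) ℝ))⁻¹).trace = ∑ i, 1 / (hF.eigenvalues i - x) := by
  have hs := hF.spectral_theorem
  rw [Unitary.conjStarAlgAut_apply] at hs
  set U : Matrix (Fin n) (Fin n) ℝ := (hF.eigenvectorUnitary : Matrix (Fin n) (Fin n) ℝ) with hU
  have h1 : U * star U = 1 := Unitary.coe_mul_star_self hF.eigenvectorUnitary
  have h2 : star U * U = 1 := Unitary.coe_star_mul_self hF.eigenvectorUnitary
  set V := star U with hV
  have hs' : F = U * Matrix.diagonal hF.eigenvalues * V := by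
    simpa using hs
  have hinv : (F - x • (1 : Matrix (Fin n) (Fin n) ℝ))⁻¹
      = U * Matrix.diagonal (fun i => 1 / (hF.eigenvalues i - x)) * V := by
    apply Matrix.inv_eq_right_inv
    have e : F - x • (1 : Matrix (Fin n) (Fin n) ℝ)
        = U * Matrix.diagonal (fun i => hF.eigenvalues i - x) * V := by
      have : Matrix.diagonal (fun i => hF.eigenvalues i - x)
          = Matrix.diagonal hF.eigenvalues - x • (1 : Matrix (Fin n) (Fin n) ℝ) := by
        rw [Matrix.smul_one_eq_diagonal, Matrix.diagonal_sub]
      rw [this, mul_sub, sub_mul, ← hs']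
      simp [h1]
    rw [e]
    calc _ = U * Matrix.diagonal (fun i => hF.eigenvalues i - x) * (V * U)
          * Matrix.diagonal (fun i => 1 / (hF.eigenvalues i - x)) * V := by
            simp only [mul_assoc]
      _ = U * (Matrix.diagonal (fun i => hF.eigenvalues i - x)
          * Matrix.diagonal (fun i => 1 / (hF.eigenvalues i - x))) * V := by
            rw [h2]; simp only [mul_assoc, mul_one]
      _ = 1 := by
            rw [Matrix.diagonal_mul_diagonal]
            have : (fun i => (hF.eigenvalues i - x) * (1 / (hF.eigenvalues i - x)))
                = fun _ => (1 : ℝ) := by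
              funext i
              exact mul_one_div_cancel (sub_pos.2 (hx i)).ne'
            rw [this, Matrix.diagonal_one, mul_one, h1]
  rw [hinv, Matrix.trace_mul_comm, ← mul_assoc, h2, one_mul, Matrix.trace_diagonal]

/-- With `δ = ε³/(32n)`, if `g(θ*) = 1` for `θ* ∈ (0, λ_min(F))` and
`(1-δ)·θ* ≤ θ < θ*` with `θ ∈ (0, λ_min(F))`, then `1 - ε < g(θ) < 1`. -/
theorem g_theta_approx
    {n : ℕ} (hn : 1 ≤ n) (ε : ℝ) (hε : ε ∈ Set.Ioc (0 : ℝ) 1)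
    (F : Matrix (Fin n) (Fin n) ℝ) (hF : F.PosDef)
    (lam : ℝ) (hlam : lam = ⨅ i, hF.1.eigenvalues i)
    (g : ℝ → ℝ)
    (hg : ∀ x : ℝ,
      g x = (ε * x / (n : ℝ)) * ((F - x • (1 : Matrix (Fin n) (Fin n) ℝ))⁻¹).trace)
    (δ : ℝ) (hδ : δ = ε ^ 3 / (32 * (n : ℝ)))
    (θs θ : ℝ) (hθs : θs ∈ Set.Ioo (0 : ℝ) lam) (hθ : θ ∈ Set.Ioo (0 : ℝ) lam)
    (hgθs : g θs = 1) (hlow : (1 - δ) * θs ≤ θ) (hupp : θ < θs) :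
    1 - ε < g θ ∧ g θ < 1 := by
  obtain ⟨he0, he1⟩ := hε
  obtain ⟨ha0, ha1⟩ := hθs
  obtain ⟨ht0, ht1⟩ := hθ
  have hle : ∀ i, lam ≤ hF.1.eigenvalues i := fun i => by
    rw [hlam]; exact ciInf_le (Set.finite_range _).bddBelow i
  have hn' : (1 : ℝ) ≤ n := by exact_mod_cast hn
  have hn0 : (0 : ℝ) < n := by linarith
  have : Nonempty (Fin n) := ⟨⟨0, hn⟩⟩
  have hform : ∀ x, x < lam → g x = ∑ i, (ε / n) * (x / (hF.1.eigenvalues i - x)) := by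
    intro x hx
    rw [hg, trace_resolvent_aux F hF.1 x (fun i => hx.trans_le (hle i)), Finset.mul_sum]
    refine Finset.sum_congr rfl fun i _ => ?_
    ring
  have hen : 0 < ε / n := by positivity
  have hm : ∀ i, 0 < hF.1.eigenvalues i - θs := fun i => by linarith [hle i]
  have hmt : ∀ i, 0 < hF.1.eigenvalues i - θ := fun i => by linarith [hle i]
  rw [hform θs ha1] at hgθs
  have hone : ∀ i, ε * θs ≤ n * (hF.1.eigenvalues i - θs) := by
    intro i
    have h := Finset.single_le_sum (f := fun i => (ε / n) * (θs / (hF.1.eigenvalues i - θs)))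
      (fun j _ => by have := hm j; positivity) (Finset.mem_univ i)
    rw [hgθs] at h
    rw [div_mul_div_comm, div_le_one (mul_pos hn0 (hm i))] at h
    exact h
  have hδn : δ * n = ε ^ 3 / 32 := by rw [hδ]; field_simp
  have hδ0 : 0 < δ := by rw [hδ]; positivity
  have hδe : δ ≤ ε / 32 := by
    have : δ ≤ δ * n := le_mul_of_one_le_right hδ0.le hn'
    nlinarith [pow_le_of_le_one he0.le he1 (n := 3) (by norm_num)]
  rw [hform θ ht1]
  constructor
  · have : 1 - ε = ∑ i, (1 - ε) * ((ε / n) * (θs / (hF.1.eigenvalues i - θs))) := by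
      rw [← Finset.mul_sum, hgθs, mul_one]
    rw [this]
    refine Finset.sum_lt_sum_of_nonempty Finset.univ_nonempty fun i _ => ?_
    rw [mul_left_comm]
    refine mul_lt_mul_of_pos_left ?_ hen
    rw [← mul_div_assoc, div_lt_div_iff₀ (hm i) (hmt i)]
    have hmi := hm i
    have ho := hone i
    have eq : hF.1.eigenvalues i - θ = (hF.1.eigenvalues i - θs) + (θs - θ) := by ring
    rw [eq]
    generalize hF.1.eigenvalues i - θs = m at *
    have h1 : θs - θ ≤ δ * θs := by linarith
    have h2 : δ * θs ≤ ε ^ 2 / 32 * m := by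
      have h3 : δ * (ε * θs) ≤ δ * (n * m) := mul_le_mul_of_nonneg_left ho hδ0.le
      have h4 : ε * (δ * θs) ≤ ε * (ε ^ 2 / 32 * m) := by
        calc _ = δ * (ε * θs) := by ring
          _ ≤ _ := h3
          _ = (δ * n) * m := by ring
          _ = _ := by rw [hδn]; ring
      exact le_of_mul_le_mul_left h4 he0
    have hc : 0 ≤ (1 - ε) * θs := mul_nonneg (by linarith) ha0.le
    calc (1 - ε) * θs * (m + (θs - θ)) ≤ (1 - ε) * θs * (m + ε ^ 2 / 32 * m) :=
          mul_le_mul_of_nonneg_left (by linarith) hc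
      _ = ((1 - ε) * (1 + ε ^ 2 / 32)) * (θs * m) := by ring
      _ < (1 - δ) * (θs * m) := by
          refine mul_lt_mul_of_pos_right ?_ (mul_pos ha0 hmi)
          nlinarith [pow_pos he0 3, mul_pos he0 he0]
      _ = ((1 - δ) * θs) * m := by ring
      _ ≤ θ * m := mul_le_mul_of_nonneg_right hlow hmi.le
  · rw [← hgθs]
    refine Finset.sum_lt_sum_of_nonempty Finset.univ_nonempty fun i _ => ?_
    refine mul_lt_mul_of_pos_left ?_ hen
    rw [div_lt_div_iff₀ (hmt i) (hm i)]
    have : 0 < hF.1.eigenvalues i := by linarith [hle i]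
    nlinarith
end

section
/- Let n ≥ 1 be a natural number, let ε ∈ (0,1] be a real number, let F be an n×n real symmetric positive definite matrix, and define g(x) := (ε·x/n)·Tr((F − x·I)^{-1}) for x ∈ (0, λ_min(F)). Then: (a) if θ* ∈ (0, λ_min(F)) satisfies g(θ*) = 1, then λ_min(F)/(1+ε) ≤ θ* ≤ λ_min(F)/(1+ε/n); and (b) if θ ∈ (0, λ_min(F)) satisfies 1 − ε < g(θ) < 1, then (1−ε)·λ_min(F) < θ < λ_min(F)/(1+ε/n). -/
theorem trace_inv_aux {n : ℕ} (F : Matrix (Fin n) (Fin n) ℝ) (hF : F.IsHermitian) (x : ℝ)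
    (hx : ∀ i, x < hF.eigenvalues i) :
    ((F - x • (1 : Matrix (Fin n) (Fin n) ℝ))⁻¹).trace = ∑ i, (hF.eigenvalues i - x)⁻¹ := by
  obtain ⟨U, V, hUV, hVU, hs⟩ : ∃ U V : Matrix (Fin n) (Fin n) ℝ, U * V = 1 ∧ V * U = 1 ∧
      F = U * Matrix.diagonal hF.eigenvalues * V := by
    refine ⟨hF.eigenvectorUnitary, star (hF.eigenvectorUnitary : Matrix (Fin n) (Fin n) ℝ),
      by simp, by simp, ?_⟩
    have h := hF.spectral_theorem
    simpa [Unitary.conjStarAlgAut_apply, Function.comp_def] using h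
  have h1 : (F - x • (1 : Matrix (Fin n) (Fin n) ℝ))
      = U * Matrix.diagonal (fun i => hF.eigenvalues i - x) * V := by
    have : Matrix.diagonal (fun i => hF.eigenvalues i - x)
        = Matrix.diagonal hF.eigenvalues - x • (1 : Matrix (Fin n) (Fin n) ℝ) := by
      ext i j
      by_cases hij : i = j
      · subst hij; simp
      · simp [hij]
    rw [this, Matrix.mul_sub, Matrix.sub_mul, ← hs]
    simp [hUV]
  have h2 : (F - x • (1 : Matrix (Fin n) (Fin n) ℝ))⁻¹
      = U * Matrix.diagonal (fun i => (hF.eigenvalues i - x)⁻¹) * V := by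
    apply Matrix.inv_eq_right_inv
    rw [h1]
    have hd : Matrix.diagonal (fun i => hF.eigenvalues i - x) *
        Matrix.diagonal (fun i => (hF.eigenvalues i - x)⁻¹) = 1 := by
      rw [Matrix.diagonal_mul_diagonal, ← Matrix.diagonal_one]
      congr 1
      funext i
      exact mul_inv_cancel₀ (sub_pos.2 (hx i)).ne'
    calc _ = U * (Matrix.diagonal (fun i => hF.eigenvalues i - x) * (V * U) *
        Matrix.diagonal (fun i => (hF.eigenvalues i - x)⁻¹)) * V := by
          simp only [Matrix.mul_assoc]
      _ = 1 := by rw [hVU, Matrix.mul_one, hd, Matrix.mul_one, hUV]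
  rw [h2, Matrix.trace_mul_comm, ← Matrix.mul_assoc, hVU, Matrix.one_mul, Matrix.trace_diagonal]

/-- (a) if `g(θ*) = 1` for `θ* ∈ (0, λ_min(F))` then
`λ_min(F)/(1+ε) ≤ θ* ≤ λ_min(F)/(1+ε/n)`; (b) if `1 - ε < g(θ) < 1` for
`θ ∈ (0, λ_min(F))` then `(1-ε)·λ_min(F) < θ < λ_min(F)/(1+ε/n)`. -/
theorem theta_approximates_lambda_min
    {n : ℕ} (hn : 1 ≤ n) (ε : ℝ) (hε : ε ∈ Set.Ioc (0 : ℝ) 1)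
    (F : Matrix (Fin n) (Fin n) ℝ) (hF : F.PosDef)
    (lam : ℝ) (hlam : lam = ⨅ i, hF.1.eigenvalues i)
    (g : ℝ → ℝ)
    (hg : ∀ x : ℝ,
      g x = (ε * x / (n : ℝ)) * ((F - x • (1 : Matrix (Fin n) (Fin n) ℝ))⁻¹).trace) :
    (∀ θs ∈ Set.Ioo (0 : ℝ) lam, g θs = 1 →
      lam / (1 + ε) ≤ θs ∧ θs ≤ lam / (1 + ε / (n : ℝ))) ∧
    (∀ θ ∈ Set.Ioo (0 : ℝ) lam, 1 - ε < g θ → g θ < 1 →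
      (1 - ε) * lam < θ ∧ θ < lam / (1 + ε / (n : ℝ))) := by
  have hn0 : (0 : ℝ) < n := by exact_mod_cast hn
  have hn1 : (1 : ℝ) ≤ n := by exact_mod_cast hn
  obtain ⟨hε0, hε1⟩ := hε
  haveI : Nonempty (Fin n) := ⟨⟨0, hn⟩⟩
  have hle : ∀ i, lam ≤ hF.1.eigenvalues i := fun i => by
    rw [hlam]; exact ciInf_le (Set.finite_range _).bddBelow i
  obtain ⟨i₀, hi₀⟩ := exists_eq_ciInf_of_finite (f := hF.1.eigenvalues)
  rw [← hlam] at hi₀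
  have key : ∀ x ∈ Set.Ioo (0 : ℝ) lam,
      ε * x ≤ g x * n * (lam - x) ∧ g x * (lam - x) ≤ ε * x := by
    rintro x ⟨hx0, hxl⟩
    have hd : 0 < lam - x := sub_pos.2 hxl
    have ht := trace_inv_aux F hF.1 x (fun i => hxl.trans_le (hle i))
    have hlow : (lam - x)⁻¹ ≤ ∑ i, (hF.1.eigenvalues i - x)⁻¹ := by
      rw [← hi₀]
      exact Finset.single_le_sum (f := fun i => (hF.1.eigenvalues i - x)⁻¹)
        (fun i _ => inv_nonneg.2 (by linarith [hle i])) (Finset.mem_univ i₀)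
    have hup : ∑ i, (hF.1.eigenvalues i - x)⁻¹ ≤ n * (lam - x)⁻¹ := by
      have := Finset.sum_le_card_nsmul Finset.univ (fun i => (hF.1.eigenvalues i - x)⁻¹)
        (lam - x)⁻¹ (fun i _ => inv_anti₀ hd (by linarith [hle i]))
      simpa using this
    rw [hg x, ht]
    generalize (∑ i, (hF.1.eigenvalues i - x)⁻¹) = S at hlow hup
    have h1 : 1 ≤ S * (lam - x) := by
      rwa [inv_le_iff_one_le_mul₀ hd] at hlow
    have h2 : S * (lam - x) ≤ n := by
      rwa [← div_eq_mul_inv, le_div_iff₀ hd] at hup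
    have hex : 0 < ε * x := mul_pos hε0 hx0
    constructor
    · have : ε * x / n * S * n * (lam - x) = ε * x * (S * (lam - x)) := by field_simp
      rw [this]; nlinarith
    · have : ε * x / n * S * (lam - x) = ε * x / n * (S * (lam - x)) := by ring
      rw [this]
      calc _ ≤ ε * x / n * n := by gcongr
        _ = ε * x := by field_simp
  have hp : 0 < 1 + ε / (n : ℝ) := by positivity
  have hr : ∀ x, x * (1 + ε / (n : ℝ)) = x + ε * x / n := fun x => by ring
  constructor
  · intro x hx h
    obtain ⟨k1, k2⟩ := key x hx
    rw [h] at k1 k2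
    constructor
    · rw [div_le_iff₀ (by linarith)]; linarith
    · rw [le_div_iff₀ hp, hr]
      have : ε * x / n ≤ lam - x := by rw [div_le_iff₀ hn0]; linarith
      linarith
  · intro x hx h h'
    obtain ⟨k1, k2⟩ := key x hx
    have hd : 0 < lam - x := sub_pos.2 hx.2
    constructor
    · have := mul_lt_mul_of_pos_right h hd
      linarith
    · rw [lt_div_iff₀ hp, hr]
      have : ε * x / n < lam - x := by
        rw [div_lt_iff₀ hn0]
        have := mul_lt_mul_of_pos_right h' (mul_pos hn0 hd)
        linarith
      linarith
end

section
/- Let n ≥ 1 be a natural number, let ε ∈ (0,1] be a real number, let F be an n×n real symmetric positive definite matrix, and let θ ∈ (0, λ_min(F)) satisfy 1 − ε < (ε·θ/n)·Tr((F − θ·I)^{-1}) < 1. Define X := (ε·θ/n)·(F − θ·I)^{-1}. Then θ < Tr(X·F) < (1+ε)·θ. -/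
/-- If `θ ∈ (0, λ_min(F))` satisfies `1-ε < (ε·θ/n)·Tr((F-θ·I)⁻¹) < 1`
and `X = (ε·θ/n)·(F-θ·I)⁻¹`, then `θ < Tr(X·F) < (1+ε)·θ`. -/
theorem trace_XF_approx
    {n : ℕ} (hn : 1 ≤ n) (ε : ℝ) (hε : ε ∈ Set.Ioc (0 : ℝ) 1)
    (F : Matrix (Fin n) (Fin n) ℝ) (hF : F.PosDef)
    (lam : ℝ) (hlam : lam = ⨅ i, hF.1.eigenvalues i)
    (θ : ℝ) (hθ : θ ∈ Set.Ioo (0 : ℝ) lam)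
    (hg1 : 1 - ε <
      (ε * θ / (n : ℝ)) * ((F - θ • (1 : Matrix (Fin n) (Fin n) ℝ))⁻¹).trace)
    (hg2 : (ε * θ / (n : ℝ)) * ((F - θ • (1 : Matrix (Fin n) (Fin n) ℝ))⁻¹).trace < 1)
    (X : Matrix (Fin n) (Fin n) ℝ)
    (hX : X = (ε * θ / (n : ℝ)) • (F - θ • (1 : Matrix (Fin n) (Fin n) ℝ))⁻¹) :
    θ < (X * F).trace ∧ (X * F).trace < (1 + ε) * θ := by
  obtain ⟨hε0, hε1⟩ := hε
  obtain ⟨hθ0, hθ1⟩ := hθ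
  have hn0 : (n : ℝ) ≠ 0 := by
    have : n ≠ 0 := by omega
    exact_mod_cast this
  -- if `F - θ I` were singular, its (junk) inverse would be zero, contradicting `hg1`
  have hdet : IsUnit (F - θ • (1 : Matrix (Fin n) (Fin n) ℝ)).det := by
    by_contra h
    rw [Matrix.nonsing_inv_apply_not_isUnit _ h] at hg1
    simp at hg1
    linarith
  have key : (X * F).trace = ε * θ + θ * ((ε * θ / (n : ℝ)) *
      ((F - θ • (1 : Matrix (Fin n) (Fin n) ℝ))⁻¹).trace) := by
    have hmul := Matrix.nonsing_inv_mul _ hdet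
    rw [hX]
    generalize hB : (F - θ • (1 : Matrix (Fin n) (Fin n) ℝ))⁻¹ = B at *
    have hBF : B * F = 1 + θ • B := by
      rw [mul_sub, Matrix.mul_smul, mul_one] at hmul
      exact sub_eq_iff_eq_add.mp hmul
    rw [Matrix.smul_mul, hBF, Matrix.trace_smul, Matrix.trace_add, Matrix.trace_smul,
      Matrix.trace_one, Fintype.card_fin, smul_eq_mul, smul_eq_mul]
    field_simp
  rw [key]
  constructor <;> nlinarith
end

section
/- Let n ≥ 1 be a natural number, let ε ∈ (0, 1/2) be a real number, let F be an n×n real symmetric positive semidefinite matrix with λ_max(F) > 0, and let θ > λ_max(F) satisfy 1 − ε < (ε·θ/n)·Tr((θ·I − F)^{-1}) ≤ 1. Define X := (ε·θ/n)·(θ·I − F)^{-1}. Then (1−2ε)·θ < Tr(X·F) ≤ (1−ε)·θ. -/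
/-- If `θ > λ_max(F)` satisfies `1-ε < (ε·θ/n)·Tr((θ·I-F)⁻¹) ≤ 1` and
`X = (ε·θ/n)·(θ·I-F)⁻¹`, then `(1-2ε)·θ < Tr(X·F) ≤ (1-ε)·θ`. -/
theorem trace_XF_approx_cover
    {n : ℕ} (hn : 1 ≤ n) (ε : ℝ) (hε : ε ∈ Set.Ioo (0 : ℝ) (1 / 2))
    (F : Matrix (Fin n) (Fin n) ℝ) (hF : F.PosSemidef)
    (lam : ℝ) (hlam : lam = ⨆ i, hF.1.eigenvalues i) (hlampos : 0 < lam)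
    (θ : ℝ) (hθ : lam < θ)
    (hg1 : 1 - ε <
      (ε * θ / (n : ℝ)) * ((θ • (1 : Matrix (Fin n) (Fin n) ℝ) - F)⁻¹).trace)
    (hg2 : (ε * θ / (n : ℝ)) * ((θ • (1 : Matrix (Fin n) (Fin n) ℝ) - F)⁻¹).trace ≤ 1)
    (X : Matrix (Fin n) (Fin n) ℝ)
    (hX : X = (ε * θ / (n : ℝ)) • (θ • (1 : Matrix (Fin n) (Fin n) ℝ) - F)⁻¹) :
    (1 - 2 * ε) * θ < (X * F).trace ∧ (X * F).trace ≤ (1 - ε) * θ := by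
  obtain ⟨h0, h1⟩ := hε
  have hθ0 : 0 < θ := hlampos.trans hθ
  have hn0 : (n : ℝ) ≠ 0 := by
    have : n ≠ 0 := by omega
    exact_mod_cast this
  set A := θ • (1 : Matrix (Fin n) (Fin n) ℝ) - F with hA
  have hdet : IsUnit A.det := by
    by_contra hd
    rw [Matrix.nonsing_inv_apply_not_isUnit A hd] at hg1
    simp at hg1
    linarith
  have hFA : F = θ • (1 : Matrix (Fin n) (Fin n) ℝ) - A := by rw [hA]; abel
  have hmul : A⁻¹ * F = θ • A⁻¹ - 1 := by
    have h := Matrix.nonsing_inv_mul A hdet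
    calc A⁻¹ * F = A⁻¹ * (θ • (1 : Matrix (Fin n) (Fin n) ℝ) - A) := by rw [← hFA]
      _ = θ • A⁻¹ - 1 := by rw [Matrix.mul_sub, h, Matrix.mul_smul, Matrix.mul_one]
  have htr : (X * F).trace = θ * ((ε * θ / (n : ℝ)) * (A⁻¹).trace) - ε * θ := by
    rw [hX, Matrix.smul_mul, hmul, Matrix.trace_smul, Matrix.trace_sub, Matrix.trace_smul,
      Matrix.trace_one, Fintype.card_fin, smul_eq_mul, smul_eq_mul]
    field_simp
  rw [htr]
  have a := mul_lt_mul_of_pos_left hg1 hθ0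
  have b := mul_le_mul_of_nonneg_left hg2 hθ0.le
  constructor <;> linarith
end
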